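/- Let n ≥ 2 and let H ≥ 1 be a real number. The number 𝒩(1,H) of points of ℙ(M_n(ℚ)) of Northcott–Schmidt height at most H satisfies |𝒩(1,H) − Vol(B(0,H))/(2ζ(n²))| ≤ L(1,n)·H^{n²−1} + H/2, where Vol(B(0,H)) = K_{n²}·H^{n²} and L(1,n) := 𝔖^{(n²)}/(2ζ(n²−1)) + K_{n²}/2; in particular, K_{n²}·H^{n²}/(2ζ(n²)) − (L(1,n)·H^{n²−1} + H/2) ≤ 𝒩(1,H). -/

import Mathlib

open scoped ENNReal
open MeasureTheory

noncomputable section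

instance {n : ℕ} : MeasureSpace (Matrix (Fin n) (Fin n) ℝ) :=
  inferInstanceAs (MeasureSpace (Fin n → Fin n → ℝ))

/-- Frobenius norm of a real matrix. -/
def frobNorm {n : ℕ} (M : Matrix (Fin n) (Fin n) ℝ) : ℝ :=
  Real.sqrt (∑ i, ∑ j, (M i j) ^ 2)

/-- The point of `ℙ(M_n(ℚ))` has Northcott–Schmidt height at most `H` : it admits an integer
matrix representative whose entries have greatest common divisor `1` and whose Frobenius norm
is at most `H`. -/
def heightLE {n : ℕ} (P : Projectivization ℚ (Matrix (Fin n) (Fin n) ℚ)) (H : ℝ) : Prop :=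
  ∃ (A : Matrix (Fin n) (Fin n) ℤ) (h0 : (A.map (Int.cast : ℤ → ℚ)) ≠ 0),
    (Finset.univ.gcd (fun p : Fin n × Fin n => A p.1 p.2) = 1) ∧
    P = Projectivization.mk ℚ (A.map (Int.cast : ℤ → ℚ)) h0 ∧
    frobNorm (A.map (Int.cast : ℤ → ℝ)) ≤ H

/-- `K_ℓ = π^{ℓ/2}/Γ(ℓ/2 + 1)`, the volume of the unit ball in `ℝ^ℓ`. -/
def Kvol (ℓ : ℕ) : ℝ := Real.pi ^ ((ℓ : ℝ) / 2) / Real.Gamma ((ℓ : ℝ) / 2 + 1)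

/-- `𝔖^{(m)} = Σ_{ℓ=0}^{m-1} C(m,ℓ)·K_ℓ`. -/
def Sfrak (m : ℕ) : ℝ := ∑ ℓ ∈ Finset.range m, (m.choose ℓ : ℝ) * Kvol ℓ

/-- `ζ(m) = Σ_{k≥1} 1/k^m`, the Riemann zeta function at a positive integer. -/
def zetaN (m : ℕ) : ℝ := ∑' k : ℕ, 1 / ((k : ℝ) + 1) ^ m

/-- `L(1,n) = 𝔖^{(n²)}/(2ζ(n²−1)) + K_{n²}/2`. -/
def Lone (n : ℕ) : ℝ := Sfrak (n ^ 2) / (2 * zetaN (n ^ 2 - 1)) + Kvol (n ^ 2) / 2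

/-- Counting integer vectors of squared Euclidean length at most `q`. -/
def latticeCount (ι : Type*) [Fintype ι] (q : ℝ) : ℕ :=
  Set.ncard {x : ι → ℤ | ∑ i, (x i : ℝ) ^ 2 ≤ q}

lemma abs_le_floor_sqrt {k : ℤ} {q : ℝ} (h : (k : ℝ) ^ 2 ≤ q) : |k| ≤ (⌊√q⌋₊ : ℤ) := by
  have h1 : ((k.natAbs : ℕ) : ℝ) ≤ √q := by
    rw [Nat.cast_natAbs, Int.cast_abs]
    exact Real.abs_le_sqrt h
  have h2 : k.natAbs ≤ ⌊√q⌋₊ := Nat.le_floor h1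
  rw [Int.abs_eq_natAbs]
  exact_mod_cast h2

lemma finite_lattice_ball (ι : Type*) [Fintype ι] (q : ℝ) :
    {x : ι → ℤ | ∑ i, (x i : ℝ) ^ 2 ≤ q}.Finite := by
  refine (Set.Finite.pi' (t := fun _ : ι => Set.Icc (-(⌊√q⌋₊ : ℤ)) ⌊√q⌋₊)
    fun _ => Set.finite_Icc _ _).subset ?_
  intro x hx i
  have h : (x i : ℝ) ^ 2 ≤ q :=
    (Finset.single_le_sum (f := fun i => (x i : ℝ) ^ 2) (fun j _ => sq_nonneg _)
      (Finset.mem_univ i)).trans hx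
  exact abs_le.1 (abs_le_floor_sqrt h)

lemma latticeCount_congr {ι κ : Type*} [Fintype ι] [Fintype κ] (e : ι ≃ κ) (q : ℝ) :
    latticeCount ι q = latticeCount κ q := by
  unfold latticeCount
  refine Set.ncard_congr' ((Equiv.arrowCongr e (Equiv.refl ℤ)).subtypeEquiv ?_)
  intro x
  simp only [Set.mem_ofPred_eq]
  rw [← Equiv.sum_comp e]
  simp

lemma latticeCount_of_neg (m : ℕ) {q : ℝ} (hq : q < 0) : latticeCount (Fin m) q = 0 := by
  unfold latticeCount
  convert Set.ncard_empty (Fin m → ℤ)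
  refine Set.eq_empty_of_forall_notMem fun x hx => ?_
  have : 0 ≤ ∑ i, (x i : ℝ) ^ 2 := Finset.sum_nonneg fun i _ => sq_nonneg _
  exact absurd (this.trans hx) (not_le.2 hq)

lemma latticeCount_zero {q : ℝ} (hq : 0 ≤ q) : latticeCount (Fin 0) q = 1 := by
  simp [latticeCount, hq]

lemma sum_Icc_neg_nat_of_even {f : ℤ → ℝ} (hf : ∀ k, f (-k) = f k) (N : ℕ) :
    ∑ k ∈ Finset.Icc (-(N : ℤ)) N, f k = f 0 + 2 * ∑ k ∈ Finset.range N, f ((k : ℤ) + 1) := by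
  induction N with
  | zero => simp
  | succ N ih =>
    have h : Finset.Icc (-((N + 1 : ℕ) : ℤ)) ((N + 1 : ℕ) : ℤ) =
        insert ((N : ℤ) + 1) (insert (-((N : ℤ) + 1)) (Finset.Icc (-(N : ℤ)) N)) := by
      ext k
      simp only [Finset.mem_Icc, Finset.mem_insert]
      omega
    rw [h, Finset.sum_insert (by simp; omega), Finset.sum_insert (by simp), ih,
      Finset.sum_range_succ, hf]
    ring

/-- Slicing the lattice points of a ball along the first coordinate. -/
lemma latticeCount_succ (m : ℕ) (q : ℝ) :
    (latticeCount (Fin (m + 1)) q : ℝ) = latticeCount (Fin m) q +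
      2 * ∑ k ∈ Finset.range ⌊√q⌋₊, (latticeCount (Fin m) (q - ((k : ℝ) + 1) ^ 2) : ℝ) := by
  have h1 := sum_Icc_neg_nat_of_even
    (f := fun k : ℤ => (latticeCount (Fin m) (q - (k : ℝ) ^ 2) : ℝ)) (by simp) ⌊√q⌋₊
  simp only [Int.cast_zero, ne_eq, OfNat.ofNat_ne_zero, not_false_eq_true, zero_pow, sub_zero,
    Int.cast_add, Int.cast_natCast, Int.cast_one] at h1
  rw [← h1]
  norm_cast
  classical
  have hfin := finite_lattice_ball (Fin (m + 1)) q
  unfold latticeCount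
  rw [Set.ncard_eq_toFinset_card _ hfin, Finset.card_eq_sum_card_fiberwise (f := fun x => x 0)
    (t := Finset.Icc (-(⌊√q⌋₊ : ℤ)) ⌊√q⌋₊)]
  · refine Finset.sum_congr rfl fun k _ => ?_
    rw [← Set.ncard_coe_finset]
    refine (Set.ncard_congr (fun x _ => (Fin.cons k x : Fin (m + 1) → ℤ)) ?_ ?_ ?_).symm
    · intro x hx
      have hx' : ∑ i, (x i : ℝ) ^ 2 ≤ q - (k : ℝ) ^ 2 := by simpa using hx
      simp only [Finset.coe_filter, Set.Finite.mem_toFinset, Set.mem_ofPred_eq, Fin.sum_univ_succ,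
        Fin.cons_zero, Fin.cons_succ, and_true]
      linarith
    · intro x y _ _ h
      exact (Fin.cons_injective2 h).2
    · intro y hy
      simp only [Finset.coe_filter, Set.Finite.mem_toFinset, Set.mem_ofPred_eq,
        Fin.sum_univ_succ] at hy
      refine ⟨Fin.tail y, ?_, ?_⟩
      · have h2 := hy.2 ▸ hy.1
        simp only [Set.mem_ofPred_eq, Fin.tail]
        push_cast
        linarith
      · rw [← hy.2, Fin.cons_self_tail]
  · intro x hx
    have hx' : ∑ i, (x i : ℝ) ^ 2 ≤ q := by simpa using hx
    have h : (x 0 : ℝ) ^ 2 ≤ q :=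
      (Finset.single_le_sum (f := fun i => (x i : ℝ) ^ 2) (fun j _ => sq_nonneg _)
        (Finset.mem_univ 0)).trans hx'
    simpa using abs_le.1 (abs_le_floor_sqrt h)

/-- Comparison of the sum over `ℤ` of an even function, nonincreasing on `[0, r]`, with its
integral over `[-r, r]`. -/
lemma abs_sum_sub_integral_le {f : ℝ → ℝ} {r : ℝ} (hr : 0 ≤ r)
    (hf : AntitoneOn f (Set.Icc 0 r)) (h0 : ∀ x, 0 ≤ f x) :
    |f 0 + 2 * ∑ k ∈ Finset.range ⌊r⌋₊, f ((k : ℝ) + 1) - 2 * ∫ x in (0 : ℝ)..r, f x| ≤ f 0 := by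
  set N := ⌊r⌋₊ with hN
  have hNr : (N : ℝ) ≤ r := Nat.floor_le hr
  have hrN : r < N + 1 := Nat.lt_floor_add_one r
  have hN0 : (0 : ℝ) ≤ N := Nat.cast_nonneg _
  have hanti : AntitoneOn f (Set.Icc 0 (0 + (N : ℝ))) :=
    hf.mono (Set.Icc_subset_Icc le_rfl (by simpa using hNr))
  have h1 := hanti.sum_le_integral
  have h2 := hanti.integral_le_sum
  simp only [zero_add, Nat.cast_add, Nat.cast_one] at h1 h2
  have hi1 : IntervalIntegrable f volume 0 N :=
    AntitoneOn.intervalIntegrable (by rw [Set.uIcc_of_le hN0]; simpa using hanti)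
  have hanti2 : AntitoneOn f (Set.Icc N r) := hf.mono (Set.Icc_subset_Icc hN0 le_rfl)
  have hi2 : IntervalIntegrable f volume N r :=
    AntitoneOn.intervalIntegrable (by rwa [Set.uIcc_of_le hNr])
  have hsplit := intervalIntegral.integral_add_adjacent_intervals hi1 hi2
  have h3 : 0 ≤ ∫ x in (N : ℝ)..r, f x := intervalIntegral.integral_nonneg hNr fun x _ => h0 x
  have h4 : ∫ x in (N : ℝ)..r, f x ≤ f N := by
    have := intervalIntegral.integral_mono_on hNr hi2 (intervalIntegrable_const (c := f N))
      fun x hx => hanti2 (Set.left_mem_Icc.2 hNr) hx hx.1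
    rw [intervalIntegral.integral_const, smul_eq_mul] at this
    nlinarith [h0 N]
  have h5 : ∑ k ∈ Finset.range N, f (k : ℝ) + f N =
      f 0 + ∑ k ∈ Finset.range N, f ((k : ℝ) + 1) := by
    rw [← Finset.sum_range_succ (fun k : ℕ => f k), Finset.sum_range_succ']
    push_cast
    ring
  rw [abs_le]
  constructor <;> linarith

lemma Kvol_pos (ℓ : ℕ) : 0 < Kvol ℓ :=
  div_pos (Real.rpow_pos_of_pos Real.pi_pos _) (Real.Gamma_pos_of_pos (by positivity))

lemma Kvol_zero : Kvol 0 = 1 := by simp [Kvol]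

lemma Kvol_add_two (ℓ : ℕ) : Kvol (ℓ + 2) = 2 * Real.pi / (ℓ + 2) * Kvol ℓ := by
  unfold Kvol
  have h : ((ℓ : ℝ) / 2 + 1) ≠ 0 := by positivity
  have h1 : (((ℓ + 2 : ℕ) : ℝ) / 2) = (ℓ : ℝ) / 2 + 1 := by push_cast; ring
  have hG : Real.Gamma ((ℓ : ℝ) / 2 + 1) ≠ 0 := (Real.Gamma_pos_of_pos (by positivity)).ne'
  rw [h1, Real.Gamma_add_one h, Real.rpow_add_one Real.pi_ne_zero]
  field_simp

lemma Kvol_one : Kvol 1 = 2 := by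
  unfold Kvol
  have h : Real.Gamma (1 / 2 + 1) = 1 / 2 * √Real.pi := by
    rw [Real.Gamma_add_one (by norm_num), Real.Gamma_one_half_eq]
  have hp : √Real.pi ≠ 0 := (Real.sqrt_pos.2 Real.pi_pos).ne'
  rw [Nat.cast_one, h, ← Real.sqrt_eq_rpow]
  field_simp

lemma Kvol_two : Kvol 2 = Real.pi := by
  rw [Kvol_add_two 0, Kvol_zero]; norm_num

lemma Kvol_three : Kvol 3 = 4 * Real.pi / 3 := by
  rw [Kvol_add_two 1, Kvol_one]; push_cast; ring

lemma Kvol_four : Kvol 4 = Real.pi ^ 2 / 2 := by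
  rw [Kvol_add_two 2, Kvol_two]; push_cast; ring

lemma Kvol_succ_eq_integral_sin (ℓ : ℕ) :
    2 * Kvol ℓ * ∫ θ in (0 : ℝ)..(Real.pi / 2), Real.sin θ ^ (ℓ + 1) = Kvol (ℓ + 1) := by
  induction ℓ using Nat.twoStepInduction with
  | zero => simp [Kvol_zero, Kvol_one]
  | one =>
    rw [Kvol_one, Kvol_two, integral_sin_pow]
    simp
    ring
  | more ℓ ih _ =>
    rw [show ℓ + 2 + 1 = (ℓ + 1) + 2 by ring, Kvol_add_two (ℓ + 1), ← ih, Kvol_add_two,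
      integral_sin_pow]
    simp
    field_simp
    ring

/-- The volume of the Euclidean ball of squared radius `q ≥ 0` in dimension `ℓ`. -/
def ballVol (ℓ : ℕ) (q : ℝ) : ℝ := Kvol ℓ * √q ^ ℓ

lemma ballVol_nonneg (ℓ : ℕ) (q : ℝ) : 0 ≤ ballVol ℓ q :=
  mul_nonneg (Kvol_pos ℓ).le (pow_nonneg (Real.sqrt_nonneg _) _)

lemma continuous_ballVol (ℓ : ℕ) : Continuous (ballVol ℓ) := by
  unfold ballVol
  fun_prop

lemma ballVol_mono (ℓ : ℕ) : Monotone (ballVol ℓ) := fun _ _ h =>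
  mul_le_mul_of_nonneg_left (pow_le_pow_left₀ (Real.sqrt_nonneg _) (Real.sqrt_le_sqrt h) _)
    (Kvol_pos ℓ).le

/-- Cavalieri's principle for Euclidean balls. -/
lemma integral_ballVol (ℓ : ℕ) {q : ℝ} (hq : 0 ≤ q) :
    2 * ∫ x in (0 : ℝ)..√q, ballVol ℓ (q - x ^ 2) = ballVol (ℓ + 1) q := by
  have hsub := intervalIntegral.integral_comp_mul_deriv (a := 0) (b := Real.pi / 2)
    (f := fun θ => √q * Real.cos θ) (f' := fun θ => √q * (-Real.sin θ))
    (g := fun x => ballVol ℓ (q - x ^ 2))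
    (fun θ _ => (Real.hasDerivAt_cos θ).const_mul _) (by fun_prop)
    ((continuous_ballVol ℓ).comp (by fun_prop))
  simp only [Real.cos_zero, mul_one, Real.cos_pi_div_two, mul_zero] at hsub
  rw [intervalIntegral.integral_symm, ← hsub, ← intervalIntegral.integral_neg]
  have hcongr : ∫ θ in (0 : ℝ)..(Real.pi / 2),
      -(((fun x => ballVol ℓ (q - x ^ 2)) ∘ fun θ => √q * Real.cos θ) θ * (√q * -Real.sin θ)) =
      ∫ θ in (0 : ℝ)..(Real.pi / 2), Kvol ℓ * √q ^ (ℓ + 1) * Real.sin θ ^ (ℓ + 1) := by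
    refine intervalIntegral.integral_congr fun θ hθ => ?_
    rw [Set.uIcc_of_le (by positivity)] at hθ
    have hs : 0 ≤ Real.sin θ :=
      Real.sin_nonneg_of_nonneg_of_le_pi hθ.1 (by linarith [hθ.2, Real.pi_pos])
    have h1 : q - (√q * Real.cos θ) ^ 2 = (√q * Real.sin θ) ^ 2 := by
      rw [mul_pow, mul_pow, Real.sq_sqrt hq, Real.sin_sq]
      ring
    simp only [Function.comp_apply, ballVol]
    rw [h1, Real.sqrt_sq (by positivity)]
    ring
  rw [hcongr, intervalIntegral.integral_const_mul, ballVol, ← Kvol_succ_eq_integral_sin]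
  ring

/-- The error bound `∑_{ℓ < m} C(m, ℓ) vol_ℓ` for the lattice point count. -/
def countError (m : ℕ) (q : ℝ) : ℝ := ∑ ℓ ∈ Finset.range m, (m.choose ℓ : ℝ) * ballVol ℓ q

lemma countError_succ (m : ℕ) (q : ℝ) :
    countError (m + 1) q = countError m q + ballVol m q +
      ∑ ℓ ∈ Finset.range m, (m.choose ℓ : ℝ) * ballVol (ℓ + 1) q := by
  have h1 : countError m q + ballVol m q =
      ∑ ℓ ∈ Finset.range (m + 1), (m.choose ℓ : ℝ) * ballVol ℓ q := by
    rw [Finset.sum_range_succ, countError]; simp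
  rw [h1, countError, Finset.sum_range_succ', Finset.sum_range_succ' (fun ℓ => _) m]
  simp only [Nat.choose_succ_succ, Nat.cast_add, add_mul, Finset.sum_add_distrib]
  simp
  ring

/-- Davenport-type estimate for the number of lattice points in a Euclidean ball. -/
lemma abs_latticeCount_sub_ballVol_le (m : ℕ) {q : ℝ} (hq : 0 ≤ q) :
    |(latticeCount (Fin m) q : ℝ) - ballVol m q| ≤ countError m q := by
  induction m generalizing q with
  | zero => simp [latticeCount_zero hq, ballVol, countError, Kvol_zero]
  | succ m ih =>
    have hnn : ∀ k ∈ Finset.range ⌊√q⌋₊, 0 ≤ q - ((k : ℝ) + 1) ^ 2 := by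
      intro k hk
      have h1 : k + 1 ≤ ⌊√q⌋₊ := Finset.mem_range.1 hk
      have h2 : ((k : ℝ) + 1) ≤ √q := by
        have := (Nat.le_floor_iff (Real.sqrt_nonneg q)).1 h1
        exact_mod_cast this
      have := (Real.le_sqrt (by positivity) hq).1 h2
      linarith
    have hanti : ∀ g : ℝ → ℝ, Monotone g → AntitoneOn (fun x => g (q - x ^ 2)) (Set.Icc 0 √q) :=
      fun g hg x hx y _ hxy => hg (by nlinarith [hx.1])
    have hslice : ∀ g : ℝ → ℝ, Monotone g → (∀ x, 0 ≤ g x) →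
        |g q + 2 * ∑ k ∈ Finset.range ⌊√q⌋₊, g (q - ((k : ℝ) + 1) ^ 2) -
          2 * ∫ x in (0 : ℝ)..√q, g (q - x ^ 2)| ≤ g q := by
      intro g hg hg0
      simpa using abs_sum_sub_integral_le (Real.sqrt_nonneg q) (hanti g hg) fun x => hg0 _
    have hE := hslice (countError m)
      (fun x y h => Finset.sum_le_sum fun ℓ _ =>
        mul_le_mul_of_nonneg_left (ballVol_mono ℓ h) (Nat.cast_nonneg _))
      (fun x => Finset.sum_nonneg fun ℓ _ => mul_nonneg (Nat.cast_nonneg _) (ballVol_nonneg _ _))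
    have hV := hslice (ballVol m) (ballVol_mono m) (ballVol_nonneg m)
    rw [integral_ballVol m hq] at hV
    have hint : 2 * ∫ x in (0 : ℝ)..√q, countError m (q - x ^ 2) =
        ∑ ℓ ∈ Finset.range m, (m.choose ℓ : ℝ) * ballVol (ℓ + 1) q := by
      unfold countError
      rw [intervalIntegral.integral_finsetSum, Finset.mul_sum]
      · refine Finset.sum_congr rfl fun ℓ _ => ?_
        rw [intervalIntegral.integral_const_mul, ← integral_ballVol ℓ hq]
        ring
      · intro ℓ _
        exact (((continuous_ballVol ℓ).comp (by fun_prop)).const_mul _).intervalIntegrable _ _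
    rw [hint] at hE
    have hsum : |∑ k ∈ Finset.range ⌊√q⌋₊, (latticeCount (Fin m) (q - ((k : ℝ) + 1) ^ 2) : ℝ) -
        ∑ k ∈ Finset.range ⌊√q⌋₊, ballVol m (q - ((k : ℝ) + 1) ^ 2)| ≤
        ∑ k ∈ Finset.range ⌊√q⌋₊, countError m (q - ((k : ℝ) + 1) ^ 2) := by
      rw [← Finset.sum_sub_distrib]
      exact (Finset.abs_sum_le_sum_abs _ _).trans
        (Finset.sum_le_sum fun k hk => ih (hnn k hk))
    have h0 := ih hq
    rw [latticeCount_succ, countError_succ]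
    rw [abs_le] at *
    constructor <;> linarith [hE.1, hE.2, hV.1, hV.2, hsum.1, hsum.2, h0.1, h0.2]

lemma Kvol_ratio_step {a : ℕ} {c : ℝ} (h : Kvol (a + 1) ≤ c * Kvol a) :
    Kvol (a + 3) ≤ c * Kvol (a + 2) := by
  rw [Kvol_add_two a, show a + 3 = (a + 1) + 2 by ring, Kvol_add_two (a + 1)]
  have hle : 2 * Real.pi / (((a + 1 : ℕ) : ℝ) + 2) ≤ 2 * Real.pi / ((a : ℝ) + 2) := by
    push_cast
    gcongr
    linarith
  calc 2 * Real.pi / (((a + 1 : ℕ) : ℝ) + 2) * Kvol (a + 1)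
      ≤ 2 * Real.pi / ((a : ℝ) + 2) * (c * Kvol a) :=
        mul_le_mul hle h (Kvol_pos _).le (by positivity)
    _ = c * (2 * Real.pi / ((a : ℝ) + 2) * Kvol a) := by ring

lemma Kvol_add_three_le (ℓ : ℕ) : Kvol (ℓ + 3) ≤ 4 / 3 * Kvol (ℓ + 2) := by
  induction ℓ using Nat.twoStepInduction with
  | zero => rw [Kvol_three, Kvol_two]; linarith
  | one =>
    rw [Kvol_four, Kvol_three]
    nlinarith [Real.pi_lt_d2, Real.pi_pos]
  | more ℓ ih _ => exact Kvol_ratio_step ih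

lemma Kvol_add_two_le (ℓ : ℕ) : Kvol (ℓ + 2) ≤ Real.pi / 2 * Kvol (ℓ + 1) := by
  induction ℓ using Nat.twoStepInduction with
  | zero => rw [Kvol_two, Kvol_one]; linarith
  | one =>
    rw [Kvol_three, Kvol_two]
    nlinarith [Real.pi_gt_d2, Real.pi_pos]
  | more ℓ ih _ => exact Kvol_ratio_step ih

lemma latticeCount_succ_le (m : ℕ) {q : ℝ} (hq : q < 4) :
    (latticeCount (Fin (m + 1)) q : ℝ) ≤
      latticeCount (Fin m) q + 2 * latticeCount (Fin m) (q - 1) := by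
  rw [latticeCount_succ]
  have h : ⌊√q⌋₊ < 2 := by
    rw [Nat.floor_lt (Real.sqrt_nonneg _), Real.sqrt_lt' (by norm_num)]
    norm_num
    exact hq
  have h0 : (0 : ℝ) ≤ latticeCount (Fin m) (q - 1) := Nat.cast_nonneg _
  interval_cases ⌊√q⌋₊
  · simp
  · simp

/-- Integer vectors with squared length below `4` have entries in `{-1, 0, 1}`. -/
lemma latticeCount_le_sum_choose (m : ℕ) {j : ℕ} (hj : j ≤ 4) {q : ℝ} (hq : q < j) :
    (latticeCount (Fin m) q : ℝ) ≤ ∑ k ∈ Finset.range j, (2 : ℝ) ^ k * m.choose k := by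
  induction m generalizing j q with
  | zero =>
    rcases j with _ | j
    · rw [latticeCount_of_neg 0 (by simpa using hq)]; simp
    · rw [Finset.sum_range_succ']
      rcases lt_or_ge q 0 with h | h
      · rw [latticeCount_of_neg 0 h]; simp
      · rw [latticeCount_zero h]; simp
  | succ m ih =>
    rcases j with _ | j
    · rw [latticeCount_of_neg _ (by simpa using hq)]; simp
    · have hj4 : ((j + 1 : ℕ) : ℝ) ≤ 4 := by exact_mod_cast hj
      have h1 := latticeCount_succ_le m (hq.trans_le hj4)
      have h2 := ih hj hq
      have h3 := ih (j := j) (q := q - 1) (by omega) (by push_cast at hq; linarith)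
      refine h1.trans ((add_le_add h2 (mul_le_mul_of_nonneg_left h3 zero_le_two)).trans_eq ?_)
      rw [Finset.sum_range_succ', Finset.sum_range_succ' (fun k => _) j, Finset.mul_sum]
      simp only [Nat.choose_succ_succ, Nat.cast_add, mul_add, Finset.sum_add_distrib, pow_succ]
      have : ∑ i ∈ Finset.range j, 2 * ((2 : ℝ) ^ i * m.choose i) =
          ∑ i ∈ Finset.range j, (2 : ℝ) ^ i * 2 * m.choose i :=
        Finset.sum_congr rfl fun i _ => by ring
      rw [this]
      simp
      ring

lemma sum_range_four_le_Sfrak {m : ℕ} (hm : 4 ≤ m) :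
    1 + m * 2 + (m.choose 2 : ℝ) * Real.pi + (m.choose 3 : ℝ) * (4 * Real.pi / 3) ≤ Sfrak m := by
  have h : ∑ ℓ ∈ Finset.range 4, (m.choose ℓ : ℝ) * Kvol ℓ ≤ Sfrak m :=
    Finset.sum_le_sum_of_subset_of_nonneg (Finset.range_mono hm)
      fun ℓ _ _ => mul_nonneg (Nat.cast_nonneg _) (Kvol_pos _).le
  simpa [Finset.sum_range_succ, Kvol_zero, Kvol_one, Kvol_two, Kvol_three] using h

lemma cast_choose_three (m : ℕ) :
    (m.choose 3 : ℝ) = (m : ℝ) * (m - 1) * (m - 2) / 6 := by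
  induction m with
  | zero => simp
  | succ m ih =>
    rw [Nat.choose_succ_succ' m 2, Nat.cast_add, ih, Nat.cast_choose_two]
    push_cast
    ring

/-- For small radii the lattice points are counted directly. -/
lemma latticeCount_le_of_lt_four {m : ℕ} (hm : 4 ≤ m) {q : ℝ} (h1 : 1 ≤ q) (h4 : q < 4) :
    (latticeCount (Fin m) q : ℝ) ≤ 2 / 3 * Sfrak m * √q ^ (m - 1) := by
  have hs1 : 1 ≤ √q := Real.one_le_sqrt.2 h1
  have hsq : √q ^ 2 = q := Real.sq_sqrt (by linarith)
  have hS : √q ^ 3 ≤ √q ^ (m - 1) := pow_le_pow_right₀ hs1 (by omega)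
  set S := √q ^ (m - 1)
  have hS1 : 1 ≤ S := one_le_pow₀ hs1
  have hm' : (4 : ℝ) ≤ m := by exact_mod_cast hm
  have hpi := Real.pi_gt_three
  have hC2 : (0 : ℝ) ≤ m.choose 2 := Nat.cast_nonneg _
  have hC3 : (0 : ℝ) ≤ m.choose 3 := Nat.cast_nonneg _
  have hC2π : (m.choose 2 : ℝ) * 3 ≤ m.choose 2 * Real.pi := by gcongr
  have hC3π : (m.choose 3 : ℝ) * 4 ≤ m.choose 3 * (4 * Real.pi / 3) := by
    gcongr; linarith
  have hw : 2 * (1 + m * 2) ≤ (m.choose 2 : ℝ) * Real.pi := by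
    refine le_trans ?_ hC2π
    rw [Nat.cast_choose_two]
    nlinarith
  have key : 1 + m * 2 + 1 / 2 * ((m.choose 2 : ℝ) * Real.pi) +
      1 / 2 * ((m.choose 3 : ℝ) * (4 * Real.pi / 3)) ≤ 2 / 3 * Sfrak m := by
    have := sum_range_four_le_Sfrak hm
    linarith
  refine le_trans ?_ (mul_le_mul_of_nonneg_right key (by linarith))
  have hq3 : √q ^ 3 = q * √q := by rw [pow_succ, hsq]
  have e0 : (1 + (m : ℝ) * 2) ≤ (1 + (m : ℝ) * 2) * S := le_mul_of_one_le_right (by positivity) hS1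
  have e2 : 0 ≤ 1 / 2 * ((m.choose 2 : ℝ) * Real.pi) * S := by positivity
  have e3 : 0 ≤ 1 / 2 * ((m.choose 3 : ℝ) * (4 * Real.pi / 3)) * S := by positivity
  rcases lt_or_ge q 2 with h | h
  · have hN := latticeCount_le_sum_choose m (j := 2) (by norm_num) (by exact_mod_cast h)
    simp [Finset.sum_range_succ] at hN
    linarith
  have f2 : (m.choose 2 : ℝ) * 4 ≤ 1 / 2 * ((m.choose 2 : ℝ) * Real.pi) * S := by
    have hr : 1.4 ≤ √q := by apply Real.le_sqrt_of_sq_le; norm_num; linarith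
    have : (8 / 3 : ℝ) ≤ S := by nlinarith
    nlinarith
  rcases lt_or_ge q 3 with h' | h'
  · have hN := latticeCount_le_sum_choose m (j := 3) (by norm_num) (by exact_mod_cast h')
    simp [Finset.sum_range_succ] at hN
    linarith
  have f3 : (m.choose 3 : ℝ) * 8 ≤ 1 / 2 * ((m.choose 3 : ℝ) * (4 * Real.pi / 3)) * S := by
    have hr : 1.4 ≤ √q := by apply Real.le_sqrt_of_sq_le; norm_num; linarith
    have : (4 : ℝ) ≤ S := by nlinarith
    nlinarith
  have hN := latticeCount_le_sum_choose m (j := 4) (by norm_num) (by exact_mod_cast h4)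
  simp [Finset.sum_range_succ] at hN
  linarith

lemma ballVol_le_of_lt_four {m : ℕ} (hm : 4 ≤ m) {q : ℝ} (h4 : q < 4) :
    ballVol m q ≤ 2 / 3 * Sfrak m * √q ^ (m - 1) := by
  obtain ⟨p, rfl⟩ := Nat.exists_eq_add_of_le' hm
  have hr : √q ≤ 2 := by
    rw [Real.sqrt_le_left (by norm_num)]; linarith
  have hK : Kvol (p + 4) ≤ 4 / 3 * Kvol (p + 3) := Kvol_add_three_le (p + 1)
  have hK0 := Kvol_pos (p + 3)
  have hS : ((p : ℝ) + 4) * Kvol (p + 3) ≤ Sfrak (p + 4) := by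
    have h := Finset.single_le_sum (f := fun ℓ => ((p + 4).choose ℓ : ℝ) * Kvol ℓ)
      (fun ℓ _ => mul_nonneg (Nat.cast_nonneg _) (Kvol_pos _).le)
      (Finset.mem_range.2 (Nat.lt_succ_self (p + 3)))
    simpa [Sfrak, Nat.choose_succ_self_right, add_assoc] using h
  have hKS : Kvol (p + 4) * √q ≤ 2 / 3 * Sfrak (p + 4) := by
    have h1 : Kvol (p + 4) * √q ≤ 4 / 3 * Kvol (p + 3) * 2 :=
      mul_le_mul hK hr (Real.sqrt_nonneg _) (by positivity)
    have h2 : 0 ≤ (p : ℝ) * Kvol (p + 3) := by positivity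
    linarith
  rw [ballVol, show p + 4 - 1 = p + 3 by omega, pow_succ]
  calc Kvol (p + 4) * (√q ^ (p + 3) * √q) = Kvol (p + 4) * √q * √q ^ (p + 3) := by ring
    _ ≤ _ := mul_le_mul_of_nonneg_right hKS (by positivity)

lemma countError_le_of_four_le {m : ℕ} (hm : 4 ≤ m) {q : ℝ} (h4 : 4 ≤ q) :
    countError m q ≤ 2 / 3 * Sfrak m * √q ^ (m - 1) := by
  obtain ⟨p, rfl⟩ := Nat.exists_eq_add_of_le' hm
  have hr : 2 ≤ √q := Real.le_sqrt_of_sq_le (by norm_num; linarith)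
  set r := √q with hrdef
  set w : ℕ → ℝ := fun ℓ => ((p + 4).choose ℓ : ℝ) * Kvol ℓ with hw
  have hw0 : ∀ ℓ, 0 ≤ w ℓ := fun ℓ => mul_nonneg (Nat.cast_nonneg _) (Kvol_pos _).le
  have hE : countError (p + 4) q =
      ∑ ℓ ∈ Finset.range (p + 2), w ℓ * r ^ ℓ + w (p + 2) * r ^ (p + 2) +
        w (p + 3) * r ^ (p + 3) := by
    rw [countError, Finset.sum_range_succ, Finset.sum_range_succ]
    simp only [hw, ballVol, mul_assoc, ← hrdef]
  have hS : Sfrak (p + 4) = ∑ ℓ ∈ Finset.range (p + 2), w ℓ + w (p + 2) + w (p + 3) := by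
    rw [Sfrak, Finset.sum_range_succ, Finset.sum_range_succ]
  have hrest : w (p + 1) ≤ ∑ ℓ ∈ Finset.range (p + 2), w ℓ :=
    Finset.single_le_sum (fun ℓ _ => hw0 ℓ) (Finset.mem_range.2 (Nat.lt_succ_self _))
  have hlow : ∑ ℓ ∈ Finset.range (p + 2), w ℓ * r ^ ℓ ≤
      (∑ ℓ ∈ Finset.range (p + 2), w ℓ) * (r ^ (p + 3) / 4) := by
    rw [Finset.sum_mul]
    refine Finset.sum_le_sum fun ℓ hℓ => mul_le_mul_of_nonneg_left ?_ (hw0 ℓ)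
    have h1 : r ^ ℓ ≤ r ^ (p + 1) :=
      pow_le_pow_right₀ (by linarith) (Nat.lt_succ_iff.1 (Finset.mem_range.1 hℓ))
    have h2 : r ^ (p + 3) = r ^ (p + 1) * r ^ 2 := by ring
    have h3 : (4 : ℝ) ≤ r ^ 2 := by nlinarith
    have h5 : 0 ≤ r ^ (p + 1) := by positivity
    rw [h2]
    nlinarith
  have hmid : w (p + 2) * r ^ (p + 2) ≤ w (p + 2) * (r ^ (p + 3) / 2) := by
    refine mul_le_mul_of_nonneg_left ?_ (hw0 _)
    have h5 : 0 ≤ r ^ (p + 2) := by positivity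
    rw [pow_succ r (p + 2)]
    nlinarith
  have hkey : 4 * w (p + 3) ≤ 2 * w (p + 2) + 5 * w (p + 1) := by
    have c3 : ((p + 4).choose (p + 3) : ℝ) = p + 4 := by
      rw [Nat.choose_succ_self_right]; push_cast; ring
    have c2 : ((p + 4).choose (p + 2) : ℝ) = (p + 4) * (p + 3) / 2 := by
      rw [← Nat.choose_symm_of_eq_add (show p + 4 = 2 + (p + 2) by ring), Nat.cast_choose_two]
      push_cast; ring
    have c1 : ((p + 4).choose (p + 1) : ℝ) = (p + 4) * (p + 3) * (p + 2) / 6 := by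
      rw [← Nat.choose_symm_of_eq_add (show p + 4 = 3 + (p + 1) by ring), cast_choose_three]
      push_cast; ring
    simp only [hw, c1, c2, c3]
    have k3 := Kvol_add_three_le p
    have k2 : Kvol (p + 2) ≤ 8 / 5 * Kvol (p + 1) :=
      (Kvol_add_two_le p).trans (mul_le_mul_of_nonneg_right
        (by linarith [Real.pi_lt_d2]) (Kvol_pos _).le)
    have hp : (0 : ℝ) ≤ p := Nat.cast_nonneg _
    have h2 := Kvol_pos (p + 2)
    have h1 := Kvol_pos (p + 1)
    have a1 : (16 / 3) * Kvol (p + 2) ≤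
        ((p : ℝ) + 3) * Kvol (p + 2) + 5 / 6 * (p + 3) * (p + 2) * Kvol (p + 1) := by
      have b1 : 5 * Kvol (p + 1) ≤ 5 / 6 * (p + 3) * (p + 2) * Kvol (p + 1) := by
        refine mul_le_mul_of_nonneg_right ?_ h1.le
        nlinarith
      have b2 : 0 ≤ p * Kvol (p + 2) := by positivity
      linarith
    have hp4 : (0 : ℝ) < p + 4 := by positivity
    nlinarith
  rw [hE, hS, show p + 4 - 1 = p + 3 by omega]
  have hr0 : 0 ≤ r ^ (p + 3) := by positivity
  nlinarith

lemma abs_latticeCount_sub_ballVol_le_Sfrak {m : ℕ} (hm : 4 ≤ m) {q : ℝ} (h1 : 1 ≤ q) :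
    |(latticeCount (Fin m) q : ℝ) - ballVol m q| ≤ 2 / 3 * Sfrak m * √q ^ (m - 1) := by
  rcases lt_or_ge q 4 with h4 | h4
  · have a := latticeCount_le_of_lt_four hm h1 h4
    have b := ballVol_le_of_lt_four hm h4
    have c : (0 : ℝ) ≤ latticeCount (Fin m) q := Nat.cast_nonneg _
    have d := ballVol_nonneg m q
    rw [abs_le]
    constructor <;> linarith
  · exact (abs_latticeCount_sub_ballVol_le m (by linarith)).trans (countError_le_of_four_le hm h4)

lemma summable_zetaN {m : ℕ} (hm : 2 ≤ m) : Summable fun k : ℕ => 1 / ((k : ℝ) + 1) ^ m := by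
  have h := (summable_nat_add_iff 1).2 (Real.summable_one_div_nat_pow.2 (show 1 < m by omega))
  simpa using h

lemma one_le_zetaN {m : ℕ} (hm : 2 ≤ m) : 1 ≤ zetaN m := by
  have h := (summable_zetaN hm).le_tsum 0 (fun k _ => by positivity)
  simpa [zetaN] using h

lemma zetaN_le {m : ℕ} (hm : 3 ≤ m) : zetaN m ≤ 29 / 24 := by
  have hcube : ∀ N : ℕ, ∑ k ∈ Finset.range (N + 2), 1 / ((k : ℝ) + 1) ^ 3 ≤
      29 / 24 - 1 / (2 * ((N : ℝ) + 2) * (N + 3)) := by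
    intro N
    induction N with
    | zero => norm_num [Finset.sum_range_succ]
    | succ N ih =>
      rw [show N + 1 + 2 = (N + 2) + 1 by ring, Finset.sum_range_succ]
      have hstep : 1 / (((N + 2 : ℕ) : ℝ) + 1) ^ 3 ≤ 1 / (2 * ((N : ℝ) + 2) * (N + 3)) -
          1 / (2 * (((N + 1 : ℕ) : ℝ) + 2) * (((N + 1 : ℕ) : ℝ) + 3)) := by
        have e : 1 / (2 * ((N : ℝ) + 2) * (N + 3)) -
            1 / (2 * (((N + 1 : ℕ) : ℝ) + 2) * (((N + 1 : ℕ) : ℝ) + 3)) =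
            1 / (((N : ℝ) + 2) * (N + 3) * (N + 4)) := by
          push_cast
          have h1 : (N : ℝ) + 1 + 2 = N + 3 := by ring
          have h2 : (N : ℝ) + 1 + 3 = N + 4 := by ring
          rw [h1, h2]
          field_simp
          ring
        rw [e]
        push_cast
        refine one_div_le_one_div_of_le (by positivity) ?_
        have : (0 : ℝ) ≤ N := Nat.cast_nonneg _
        nlinarith
      linarith
  refine Real.tsum_le_of_sum_range_le (fun k => by positivity) fun N => ?_
  calc ∑ k ∈ Finset.range N, 1 / ((k : ℝ) + 1) ^ m
      ≤ ∑ k ∈ Finset.range (N + 2), 1 / ((k : ℝ) + 1) ^ m :=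
        Finset.sum_le_sum_of_subset_of_nonneg (Finset.range_mono (by omega))
          fun k _ _ => by positivity
    _ ≤ ∑ k ∈ Finset.range (N + 2), 1 / ((k : ℝ) + 1) ^ 3 := by
        refine Finset.sum_le_sum fun k _ => one_div_le_one_div_of_le (by positivity) ?_
        exact pow_le_pow_right₀ (by linarith [(Nat.cast_nonneg k : (0 : ℝ) ≤ k)]) hm
    _ ≤ 29 / 24 := (hcube N).trans (sub_le_self _ (by positivity))

lemma abs_moebius_cast_le_one (d : ℕ) : |(ArithmeticFunction.moebius d : ℝ)| ≤ 1 := by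
  exact_mod_cast (ArithmeticFunction.abs_moebius_le_one (n := d))

lemma summable_moebius_div_pow {m : ℕ} (hm : 2 ≤ m) :
    Summable fun k : ℕ => (ArithmeticFunction.moebius (k + 1) : ℝ) / ((k : ℝ) + 1) ^ m := by
  refine Summable.of_norm_bounded (summable_zetaN hm) fun k => ?_
  rw [Real.norm_eq_abs, abs_div, abs_of_pos (show (0 : ℝ) < ((k : ℝ) + 1) ^ m by positivity)]
  gcongr
  exact abs_moebius_cast_le_one _

lemma LSeries_natCast_eq_tsum (f : ℕ → ℝ) {m : ℕ}
    (hf : Summable fun k : ℕ => f (k + 1) / ((k : ℝ) + 1) ^ m) :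
    LSeries (fun k => (f k : ℂ)) m = ((∑' k : ℕ, f (k + 1) / ((k : ℝ) + 1) ^ m : ℝ) : ℂ) := by
  have hterm : ∀ k : ℕ, LSeries.term (fun k => (f k : ℂ)) m (k + 1) =
      ((f (k + 1) / ((k : ℝ) + 1) ^ m : ℝ) : ℂ) := by
    intro k
    rw [LSeries.term_of_ne_zero (Nat.succ_ne_zero k), Complex.cpow_natCast]
    push_cast
    rfl
  have hs : Summable fun k : ℕ => LSeries.term (fun k => (f k : ℂ)) m (k + 1) := by
    simp only [hterm]
    exact_mod_cast hf
  rw [LSeries, ((summable_nat_add_iff 1).1 hs).tsum_eq_zero_add, LSeries.term_zero, zero_add,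
    Complex.ofReal_tsum]
  exact tsum_congr hterm

lemma tsum_moebius_div_pow {m : ℕ} (hm : 2 ≤ m) :
    ∑' k : ℕ, (ArithmeticFunction.moebius (k + 1) : ℝ) / ((k : ℝ) + 1) ^ m = 1 / zetaN m := by
  have hre : 1 < ((m : ℂ)).re := by
    rw [Complex.natCast_re]; exact_mod_cast hm
  have h := ArithmeticFunction.LSeries_zeta_mul_Lseries_moebius hre
  have hz : LSeries (fun n => (ArithmeticFunction.zeta n : ℂ)) m = (zetaN m : ℂ) := by
    have h1 := LSeries_natCast_eq_tsum (fun k => (ArithmeticFunction.zeta k : ℝ)) (m := m)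
      (by simpa using summable_zetaN hm)
    simp only [Complex.ofReal_natCast] at h1
    rw [h1]
    simp [zetaN]
  have hmu := LSeries_natCast_eq_tsum (fun k => (ArithmeticFunction.moebius k : ℝ)) (m := m)
    (summable_moebius_div_pow hm)
  simp only [Complex.ofReal_intCast] at hmu
  rw [hz, hmu] at h
  have h' : zetaN m *
      ∑' k : ℕ, (ArithmeticFunction.moebius (k + 1) : ℝ) / ((k : ℝ) + 1) ^ m = 1 := by
    exact_mod_cast h
  exact eq_one_div_of_mul_eq_one_right h'

lemma tsum_tail_le {m D : ℕ} (hm : 3 ≤ m) (hD : 1 ≤ D) {H : ℝ} (hH : H ≤ D + 1) :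
    H * ∑' k : ℕ, 1 / (((k + D : ℕ) : ℝ) + 1) ^ m ≤ zetaN (m - 1) - 1 := by
  have hs := summable_zetaN (show 2 ≤ m - 1 by omega)
  have hsm := summable_zetaN (show 2 ≤ m by omega)
  have hsplit := hs.sum_add_tsum_nat_add D
  have hfirst : 1 ≤ ∑ k ∈ Finset.range D, 1 / ((k : ℝ) + 1) ^ (m - 1) := by
    have h := Finset.single_le_sum (f := fun k : ℕ => 1 / ((k : ℝ) + 1) ^ (m - 1))
      (fun k _ => by positivity) (Finset.mem_range.2 hD)
    simpa using h
  have hle : H * ∑' k : ℕ, 1 / (((k + D : ℕ) : ℝ) + 1) ^ m ≤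
      ∑' k : ℕ, 1 / (((k + D : ℕ) : ℝ) + 1) ^ (m - 1) := by
    rw [← tsum_mul_left]
    refine Summable.tsum_le_tsum (fun k => ?_)
      (((summable_nat_add_iff (f := fun k : ℕ => 1 / ((k : ℝ) + 1) ^ m) D).2 hsm).mul_left H)
      ((summable_nat_add_iff (f := fun k : ℕ => 1 / ((k : ℝ) + 1) ^ (m - 1)) D).2 hs)
    have hx : (0 : ℝ) < ((k + D : ℕ) : ℝ) + 1 := by positivity
    have hHx : H ≤ ((k + D : ℕ) : ℝ) + 1 := by
      push_cast
      linarith [(Nat.cast_nonneg k : (0 : ℝ) ≤ k)]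
    obtain ⟨p, rfl⟩ := Nat.exists_eq_add_of_le' (show 1 ≤ m by omega)
    rw [Nat.add_sub_cancel, mul_one_div, div_le_div_iff₀ (by positivity) (by positivity), one_mul,
      pow_succ, mul_comm]
    exact mul_le_mul_of_nonneg_left hHx (by positivity)
  unfold zetaN
  linarith

lemma measurePreserving_uncurry (ι κ : Type*) [Fintype ι] [Fintype κ] :
    MeasurePreserving (MeasurableEquiv.curry ι κ ℝ).symm volume volume := by
  refine ⟨(MeasurableEquiv.curry ι κ ℝ).symm.measurable, ?_⟩
  refine (Measure.pi_eq fun s hs => ?_).symm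
  rw [MeasurableEquiv.map_apply]
  have h : (MeasurableEquiv.curry ι κ ℝ).symm ⁻¹' Set.univ.pi s =
      Set.univ.pi fun i => Set.univ.pi fun j => s (i, j) := by
    ext f
    simp [Set.mem_pi, MeasurableEquiv.curry, Function.uncurry]
  rw [h, volume_pi_pi]
  simp only [volume_pi_pi]
  rw [Fintype.prod_prod_type]

lemma volume_frobNorm_le {n : ℕ} (hn : 2 ≤ n) {H : ℝ} (hH : 0 ≤ H) :
    (volume {M : Matrix (Fin n) (Fin n) ℝ | frobNorm M ≤ H}).toReal =
      Kvol (n ^ 2) * H ^ (n ^ 2) := by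
  have : Nonempty (Fin n × Fin n) := ⟨⟨⟨0, by omega⟩, ⟨0, by omega⟩⟩⟩
  have hmp := ((EuclideanSpace.volume_preserving_symm_measurableEquiv_toLp
    (Fin n × Fin n)).symm _).comp (measurePreserving_uncurry (Fin n) (Fin n))
  have hpre : {M : Matrix (Fin n) (Fin n) ℝ | frobNorm M ≤ H} =
      ((MeasurableEquiv.toLp 2 (Fin n × Fin n → ℝ)).symm.symm ∘
        (MeasurableEquiv.curry (Fin n) (Fin n) ℝ).symm) ⁻¹'
        Metric.closedBall (0 : EuclideanSpace ℝ (Fin n × Fin n)) H := by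
    ext M
    change frobNorm M ≤ H ↔ WithLp.toLp 2 (Function.uncurry M) ∈
      Metric.closedBall (0 : EuclideanSpace ℝ (Fin n × Fin n)) H
    rw [mem_closedBall_zero_iff, EuclideanSpace.norm_eq]
    simp [Fintype.sum_prod_type, frobNorm, Function.uncurry]
  have hvol : volume {M : Matrix (Fin n) (Fin n) ℝ | frobNorm M ≤ H} =
      volume (Metric.closedBall (0 : EuclideanSpace ℝ (Fin n × Fin n)) H) := by
    rw [hpre]
    exact hmp.measure_preimage Metric.isClosed_closedBall.nullMeasurableSet
  have hcard : Fintype.card (Fin n × Fin n) = n ^ 2 := by simp [sq]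
  have hpow : √Real.pi ^ (n ^ 2) = Real.pi ^ (((n ^ 2 : ℕ) : ℝ) / 2) := by
    rw [Real.sqrt_eq_rpow, ← Real.rpow_natCast, ← Real.rpow_mul Real.pi_pos.le]
    congr 1
    ring
  rw [hvol, EuclideanSpace.volume_closedBall, hcard, hpow, ENNReal.toReal_mul, ENNReal.toReal_pow,
    ENNReal.toReal_ofReal hH]
  change _ * (ENNReal.ofReal (Kvol (n ^ 2))).toReal = _
  rw [ENNReal.toReal_ofReal (Kvol_pos _).le, mul_comm]

/-- Counting primitive integer vectors of squared Euclidean length at most `q`. -/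
def primitiveCount (ι : Type*) [Fintype ι] (q : ℝ) : ℕ :=
  Set.ncard {x : ι → ℤ | Finset.univ.gcd x = 1 ∧ ∑ i, (x i : ℝ) ^ 2 ≤ q}

lemma sum_moebius_divisors (g : ℕ) :
    ∑ d ∈ g.divisors, ArithmeticFunction.moebius d = if g = 1 then 1 else 0 := by
  rw [← ArithmeticFunction.coe_mul_zeta_apply, ArithmeticFunction.moebius_mul_coe_zeta,
    ArithmeticFunction.one_apply]

lemma gcd_natAbs_le_floor_sqrt {ι : Type*} [Fintype ι] {q : ℝ} {x : ι → ℤ} (hx0 : x ≠ 0)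
    (hx : ∑ i, (x i : ℝ) ^ 2 ≤ q) : (Finset.univ.gcd x).natAbs ≤ ⌊√q⌋₊ := by
  obtain ⟨i, hi⟩ := Function.ne_iff.1 hx0
  have h : (x i : ℝ) ^ 2 ≤ q :=
    (Finset.single_le_sum (f := fun i => (x i : ℝ) ^ 2) (fun j _ => sq_nonneg _)
      (Finset.mem_univ i)).trans hx
  have h1 := abs_le_floor_sqrt h
  rw [Int.abs_eq_natAbs] at h1
  have h2 : (Finset.univ.gcd x).natAbs ≤ (x i).natAbs :=
    Nat.le_of_dvd (Int.natAbs_pos.2 hi)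
      (Int.natAbs_dvd_natAbs.2 (Finset.gcd_dvd (Finset.mem_univ i)))
  exact h2.trans (by exact_mod_cast h1)

lemma card_multiples_in_ball {ι : Type*} [Fintype ι] {q : ℝ} (hq : 0 ≤ q) {d : ℕ} (hd : 1 ≤ d) :
    Set.ncard {x : ι → ℤ | x ≠ 0 ∧ ∑ i, (x i : ℝ) ^ 2 ≤ q ∧ d ∣ (Finset.univ.gcd x).natAbs} + 1 =
      latticeCount ι (q / (d : ℝ) ^ 2) := by
  have hd0 : (0 : ℝ) < (d : ℝ) ^ 2 := by positivity
  have hdz : (d : ℤ) ≠ 0 := by exact_mod_cast (show d ≠ 0 by omega)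
  have hmem : (0 : ι → ℤ) ∈ {x : ι → ℤ | ∑ i, (x i : ℝ) ^ 2 ≤ q / (d : ℝ) ^ 2} := by
    simpa using div_nonneg hq hd0.le
  rw [latticeCount, ← Set.ncard_sdiff_singleton_add_one hmem (finite_lattice_ball ι _)]
  congr 1
  have hscale : ∀ y : ι → ℤ, ∑ i, ((((d : ℤ) * y i : ℤ)) : ℝ) ^ 2 =
      (d : ℝ) ^ 2 * ∑ i, (y i : ℝ) ^ 2 := by
    intro y
    rw [Finset.mul_sum]
    refine Finset.sum_congr rfl fun i _ => ?_
    push_cast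
    ring
  refine (Set.ncard_congr (fun y _ => fun i => (d : ℤ) * y i) ?_ ?_ ?_).symm
  · rintro y ⟨hy, hy0⟩
    refine ⟨?_, ?_, ?_⟩
    · intro h
      refine hy0 (funext fun i => ?_)
      exact (mul_eq_zero.1 (congrFun h i)).resolve_left hdz
    · rw [hscale]
      have hy' : ∑ i, (y i : ℝ) ^ 2 ≤ q / (d : ℝ) ^ 2 := hy
      rwa [le_div_iff₀' hd0] at hy'
    · exact Int.natCast_dvd.1 (Finset.dvd_gcd fun i _ => Dvd.intro _ rfl)
  · intro y z _ _ h
    funext i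
    exact mul_left_cancel₀ hdz (congrFun h i)
  · rintro x ⟨hx0, hx, hdx⟩
    have hdvd : ∀ i, (d : ℤ) ∣ x i := fun i =>
      (Int.natCast_dvd.2 hdx).trans (Finset.gcd_dvd (Finset.mem_univ i))
    choose y hy using hdvd
    have hxy : x = fun i => (d : ℤ) * y i := funext hy
    refine ⟨y, ⟨?_, ?_⟩, hxy.symm⟩
    · change ∑ i, (y i : ℝ) ^ 2 ≤ q / (d : ℝ) ^ 2
      rw [le_div_iff₀' hd0, ← hscale]
      simpa only [hxy] using hx
    · rintro rfl
      exact hx0 (hxy.trans (by ext; simp))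

/-- Möbius inversion for primitive vectors. -/
lemma primitiveCount_eq_sum_moebius (ι : Type*) [Fintype ι] {q : ℝ} (hq : 0 ≤ q) :
    (primitiveCount ι q : ℝ) = ∑ k ∈ Finset.range ⌊√q⌋₊,
      (ArithmeticFunction.moebius (k + 1) : ℝ) *
        (latticeCount ι (q / ((k : ℝ) + 1) ^ 2) - 1) := by
  classical
  set F : Finset (ι → ℤ) := (finite_lattice_ball ι q).toFinset.erase 0 with hF
  have hFmem : ∀ x, x ∈ F ↔ x ≠ 0 ∧ ∑ i, (x i : ℝ) ^ 2 ≤ q := by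
    intro x
    simp [hF]
  set g : (ι → ℤ) → ℕ := fun x => (Finset.univ.gcd x).natAbs with hg
  have hg1 : ∀ x, g x = 1 ↔ Finset.univ.gcd x = 1 := by
    intro x
    have : 0 ≤ Finset.univ.gcd x := Int.nonneg_of_normalize_eq_self Finset.normalize_gcd
    simp only [hg]
    omega
  have hprim : (primitiveCount ι q : ℤ) = ∑ x ∈ F, if g x = 1 then 1 else 0 := by
    rw [Finset.sum_boole, primitiveCount, Nat.cast_inj, ← Set.ncard_coe_finset]
    congr 1
    ext x
    simp only [Finset.coe_filter, hFmem, Set.mem_ofPred_eq, hg1]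
    constructor
    · rintro ⟨h1, h2⟩
      refine ⟨⟨?_, h2⟩, h1⟩
      rintro rfl
      have : Finset.univ.gcd (0 : ι → ℤ) = 0 := Finset.gcd_eq_zero_iff.2 fun _ _ => rfl
      rw [this] at h1
      exact zero_ne_one h1
    · rintro ⟨⟨_, h2⟩, h1⟩
      exact ⟨h1, h2⟩
  have hdiv : ∀ x ∈ F, (if g x = 1 then (1 : ℤ) else 0) = ∑ k ∈ Finset.range ⌊√q⌋₊,
      if (k + 1) ∣ g x then ArithmeticFunction.moebius (k + 1) else 0 := by
    intro x hx
    obtain ⟨hx0, hxq⟩ := (hFmem x).1 hx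
    have hle : g x ≤ ⌊√q⌋₊ := gcd_natAbs_le_floor_sqrt hx0 hxq
    have hpos : g x ≠ 0 := by
      obtain ⟨i, hi⟩ := Function.ne_iff.1 hx0
      intro h0
      exact hi (Finset.gcd_eq_zero_iff.1 (Int.natAbs_eq_zero.1 h0) i (Finset.mem_univ i))
    rw [← sum_moebius_divisors]
    have hset : (g x).divisors = {d ∈ Finset.Ico 1 (⌊√q⌋₊ + 1) | d ∣ g x} := by
      ext d
      simp only [Nat.mem_divisors, Finset.mem_filter, Finset.mem_Ico]
      constructor
      · rintro ⟨h, _⟩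
        have := Nat.le_of_dvd (Nat.pos_of_ne_zero hpos) h
        have := Nat.pos_of_dvd_of_pos h (Nat.pos_of_ne_zero hpos)
        exact ⟨⟨by omega, by omega⟩, h⟩
      · rintro ⟨_, h⟩
        exact ⟨h, hpos⟩
    rw [hset, Finset.sum_filter, Finset.sum_Ico_eq_sum_range]
    simp only [Nat.add_sub_cancel, add_comm 1]
  have hcount : ∀ k : ℕ, ((Finset.filter (fun x => (k + 1) ∣ g x) F).card : ℝ) =
      latticeCount ι (q / ((k : ℝ) + 1) ^ 2) - 1 := by
    intro k
    have h := card_multiples_in_ball (ι := ι) hq (show 1 ≤ k + 1 by omega)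
    rw [eq_sub_iff_add_eq, ← Nat.cast_succ k, ← h, ← Set.ncard_coe_finset]
    push_cast
    congr 3
    ext x
    simp [hFmem, hg, and_assoc]
  rw [Finset.sum_congr rfl hdiv, Finset.sum_comm] at hprim
  have hprim' := congrArg (Int.cast : ℤ → ℝ) hprim
  push_cast at hprim'
  rw [hprim']
  refine Finset.sum_congr rfl fun k _ => ?_
  rw [← hcount, ← Finset.sum_filter, Finset.sum_const, nsmul_eq_mul, mul_comm]

lemma primitive_ratio {ι : Type*} [Fintype ι] {x y : ι → ℤ} (hx : Finset.univ.gcd x = 1)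
    (hy : Finset.univ.gcd y = 1) {a : ℚ} (h : ∀ i, a * (y i : ℚ) = x i) : x = y ∨ x = -y := by
  have hden : (a.den : ℤ) ≠ 0 := by exact_mod_cast a.den_ne_zero
  have hint : ∀ i, a.num * y i = a.den * x i := by
    intro i
    have h1 : (a.num : ℚ) = a * a.den := (Rat.mul_den_eq_num a).symm
    have : (a.num : ℚ) * y i = a.den * x i := by
      rw [← h i, h1]; ring
    exact_mod_cast this
  have hg : (Finset.univ.gcd fun i => a.num * y i) = Finset.univ.gcd fun i => (a.den : ℤ) * x i :=
    Finset.gcd_congr rfl fun i _ => hint i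
  rw [Finset.gcd_mul_left, Finset.gcd_mul_left, hx, hy, mul_one, mul_one, Int.normalize_coe_nat,
    ← Int.abs_eq_normalize] at hg
  rcases abs_eq (Int.natCast_nonneg a.den) |>.1 hg with h1 | h1
  · left
    funext i
    have := hint i
    rw [h1] at this
    exact (mul_left_cancel₀ hden this).symm
  · right
    funext i
    have := hint i
    rw [h1, neg_mul, ← mul_neg] at this
    exact (mul_left_cancel₀ hden this).symm

lemma gcd_neg_eq {ι : Type*} [Fintype ι] (x : ι → ℤ) :
    Finset.univ.gcd (-x) = Finset.univ.gcd x := by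
  have h : (Finset.univ.gcd fun i => (-1 : ℤ) * x i) = normalize (-1) * Finset.univ.gcd x :=
    Finset.gcd_mul_left
  have h1 : normalize (-1 : ℤ) = 1 := by rw [← Int.abs_eq_normalize]; rfl
  rw [h1, one_mul] at h
  rw [← h]
  congr 1
  funext i
  simp

/-- Every point of height at most `H` has exactly two primitive representatives. -/
lemma two_mul_ncard_heightLE (n : ℕ) {H : ℝ} (hH : 0 ≤ H) :
    2 * Set.ncard {P : Projectivization ℚ (Matrix (Fin n) (Fin n) ℚ) | heightLE P H} =
      primitiveCount (Fin n × Fin n) (H ^ 2) := by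
  classical
  set S : Set (Fin n × Fin n → ℤ) :=
    {x | Finset.univ.gcd x = 1 ∧ ∑ i, (x i : ℝ) ^ 2 ≤ H ^ 2} with hS
  have hSfin : S.Finite := (finite_lattice_ball _ (H ^ 2)).subset fun x hx => hx.2
  let toMat : (Fin n × Fin n → ℤ) → Matrix (Fin n) (Fin n) ℚ :=
    fun x => Matrix.of fun i j => (x (i, j) : ℚ)
  have hne : ∀ x : Fin n × Fin n → ℤ, Finset.univ.gcd x = 1 → toMat x ≠ 0 := by
    intro x hx h0
    have : Finset.univ.gcd x = 0 := Finset.gcd_eq_zero_iff.2 fun p _ => by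
      have := congrFun (congrFun h0 p.1) p.2
      simpa [toMat] using this
    rw [this] at hx
    exact zero_ne_one hx
  let pt : S → Projectivization ℚ (Matrix (Fin n) (Fin n) ℚ) :=
    fun x => Projectivization.mk ℚ (toMat x.1) (hne x.1 x.2.1)
  have hrange : {P : Projectivization ℚ (Matrix (Fin n) (Fin n) ℚ) | heightLE P H} =
      Set.range pt := by
    ext P
    constructor
    · rintro ⟨A, h0, hg, rfl, hA⟩
      refine ⟨⟨fun p => A p.1 p.2, hg, ?_⟩, rfl⟩
      rw [frobNorm, Real.sqrt_le_left hH] at hA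
      simpa [Fintype.sum_prod_type] using hA
    · rintro ⟨⟨x, hg, hx⟩, rfl⟩
      refine ⟨Matrix.of fun i j => x (i, j), hne x hg, hg, rfl, ?_⟩
      rw [frobNorm, Real.sqrt_le_left hH]
      simpa [Fintype.sum_prod_type] using hx
  have : Fintype S := hSfin.fintype
  have hfiber : ∀ x y : S, pt x = pt y ↔ x.1 = y.1 ∨ x.1 = -y.1 := by
    intro x y
    rw [Projectivization.mk_eq_mk_iff']
    constructor
    · rintro ⟨a, ha⟩
      refine primitive_ratio x.2.1 y.2.1 (a := a) fun p => ?_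
      exact congrFun (congrFun ha p.1) p.2
    · rintro (h | h)
      · exact ⟨1, by rw [one_smul, h]⟩
      · refine ⟨-1, ?_⟩
        rw [h]
        ext i j
        simp [toMat]
  have hcard : (Finset.univ : Finset S).card = 2 * (Finset.univ.image pt).card := by
    rw [Finset.card_eq_sum_card_image pt, Finset.sum_const_nat (m := 2), mul_comm]
    intro P hP
    obtain ⟨y, -, rfl⟩ := Finset.mem_image.1 hP
    have hy := y.2
    have hneg : -y.1 ∈ S := ⟨by rw [gcd_neg_eq]; exact hy.1, by simpa using hy.2⟩
    rw [Finset.card_eq_two]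
    refine ⟨y, ⟨-y.1, hneg⟩, ?_, ?_⟩
    · intro h
      have h' : y.1 = -y.1 := congrArg Subtype.val h
      have h0 : Finset.univ.gcd y.1 = 0 := Finset.gcd_eq_zero_iff.2 fun p _ => by
        have : y.1 p = -y.1 p := congrFun h' p
        omega
      rw [hy.1] at h0
      exact one_ne_zero h0
    · ext x
      simp only [Finset.mem_filter, Finset.mem_univ, true_and, hfiber, Finset.mem_insert,
        Finset.mem_singleton, Subtype.ext_iff]
  rw [hrange, primitiveCount, ← hS, ← Nat.card_coe_set_eq S, Nat.card_eq_fintype_card,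
    ← Finset.card_univ, hcard, ← Set.ncard_coe_finset]
  simp

/-- The estimate for the number of primitive vectors in dimension `m ≥ 4`. -/
lemma abs_primitiveCount_sub_le {ι : Type*} [Fintype ι] {m : ℕ} (hι : Fintype.card ι = m)
    (hm : 4 ≤ m) {H : ℝ} (hH : 1 ≤ H) :
    |(primitiveCount ι (H ^ 2) : ℝ) - Kvol m * H ^ m / zetaN m| ≤
      (Sfrak m / zetaN (m - 1) + Kvol m) * H ^ (m - 1) + H := by
  have hH0 : 0 ≤ H := by linarith
  set D := ⌊H⌋₊ with hD
  have hD1 : 1 ≤ D := Nat.le_floor (by simpa using hH)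
  have hDH : (D : ℝ) ≤ H := Nat.floor_le hH0
  have hHD : H < D + 1 := Nat.lt_floor_add_one H
  set μ : ℕ → ℝ := fun k => (ArithmeticFunction.moebius (k + 1) : ℝ) with hμ
  have hμ1 : ∀ k, |μ k| ≤ 1 := fun k => abs_moebius_cast_le_one _
  set e : ℕ → ℝ := fun k => latticeCount ι (H ^ 2 / ((k : ℝ) + 1) ^ 2) -
    Kvol m * H ^ m / ((k : ℝ) + 1) ^ m with he
  set ζ' := zetaN (m - 1) with hζ'
  have hζ1 : 1 ≤ ζ' := one_le_zetaN (by omega)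
  have hζ2 : ζ' ≤ 29 / 24 := zetaN_le (by omega)
  have hs := summable_zetaN (show 2 ≤ m by omega)
  have hs' := summable_zetaN (show 2 ≤ m - 1 by omega)
  have hSf : 0 ≤ Sfrak m :=
    Finset.sum_nonneg fun ℓ _ => mul_nonneg (Nat.cast_nonneg _) (Kvol_pos _).le
  have hsμ := summable_moebius_div_pow (show 2 ≤ m by omega)
  have hsplit := hsμ.sum_add_tsum_nat_add D
  rw [tsum_moebius_div_pow (by omega)] at hsplit
  set T := ∑' k : ℕ, (ArithmeticFunction.moebius (k + D + 1) : ℝ) / (((k + D : ℕ) : ℝ) + 1) ^ m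
    with hT
  have hdecomp : (primitiveCount ι (H ^ 2) : ℝ) - Kvol m * H ^ m / zetaN m =
      ∑ k ∈ Finset.range D, μ k * e k - ∑ k ∈ Finset.range D, μ k - Kvol m * H ^ m * T := by
    rw [primitiveCount_eq_sum_moebius ι (by positivity), Real.sqrt_sq hH0, ← hD,
      div_eq_mul_one_div (Kvol m * H ^ m), ← hsplit, mul_add, Finset.mul_sum,
      ← Finset.sum_sub_distrib, ← sub_sub, ← Finset.sum_sub_distrib]
    congr 1
    refine Finset.sum_congr rfl fun k _ => ?_
    simp only [hμ, he]
    ring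
  have he_le : ∀ k ∈ Finset.range D,
      |e k| ≤ 2 / 3 * Sfrak m * H ^ (m - 1) * (1 / ((k : ℝ) + 1) ^ (m - 1)) := by
    intro k hk
    have hk1 : (0 : ℝ) < (k : ℝ) + 1 := by positivity
    have hkH : (k : ℝ) + 1 ≤ H := by
      have : ((k + 1 : ℕ) : ℝ) ≤ D := by exact_mod_cast Finset.mem_range.1 hk
      push_cast at this
      linarith
    have hq : 1 ≤ H ^ 2 / ((k : ℝ) + 1) ^ 2 := by
      rw [one_le_div (by positivity)]
      gcongr
    have hsqrt : √(H ^ 2 / ((k : ℝ) + 1) ^ 2) = H / ((k : ℝ) + 1) := by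
      rw [← div_pow, Real.sqrt_sq (by positivity)]
    have h := abs_latticeCount_sub_ballVol_le_Sfrak hm hq
    rw [ballVol, hsqrt, div_pow, div_pow] at h
    simp only [he]
    rw [latticeCount_congr (Fintype.equivFinOfCardEq hι)]
    convert h using 1
    · ring_nf
    · ring
  have hsum1 : |∑ k ∈ Finset.range D, μ k * e k| ≤ 2 / 3 * Sfrak m * H ^ (m - 1) * ζ' := by
    calc |∑ k ∈ Finset.range D, μ k * e k|
        ≤ ∑ k ∈ Finset.range D, |μ k * e k| := Finset.abs_sum_le_sum_abs _ _
      _ ≤ ∑ k ∈ Finset.range D,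
          2 / 3 * Sfrak m * H ^ (m - 1) * (1 / ((k : ℝ) + 1) ^ (m - 1)) := by
          refine Finset.sum_le_sum fun k hk => ?_
          rw [abs_mul]
          exact (mul_le_of_le_one_left (abs_nonneg _) (hμ1 k)).trans (he_le k hk)
      _ = 2 / 3 * Sfrak m * H ^ (m - 1) *
          ∑ k ∈ Finset.range D, 1 / ((k : ℝ) + 1) ^ (m - 1) := by rw [Finset.mul_sum]
      _ ≤ _ := mul_le_mul_of_nonneg_left
          (hs'.sum_le_tsum _ fun k _ => by positivity) (by positivity)
  have hsum2 : |∑ k ∈ Finset.range D, μ k| ≤ H := by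
    refine (Finset.abs_sum_le_sum_abs _ _).trans
      ((Finset.sum_le_sum fun k _ => hμ1 k).trans ?_)
    simpa using hDH
  have hTle : |T| ≤ ∑' k : ℕ, 1 / (((k + D : ℕ) : ℝ) + 1) ^ m := by
    rw [← Real.norm_eq_abs]
    refine tsum_of_norm_bounded
      ((summable_nat_add_iff (f := fun k : ℕ => 1 / ((k : ℝ) + 1) ^ m) D).2 hs).hasSum
      fun k => ?_
    rw [Real.norm_eq_abs, abs_div,
      abs_of_pos (show (0 : ℝ) < (((k + D : ℕ) : ℝ) + 1) ^ m by positivity)]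
    gcongr
    exact abs_moebius_cast_le_one _
  have hsum3 : |Kvol m * H ^ m * T| ≤ Kvol m * H ^ (m - 1) := by
    have hK := Kvol_pos m
    have htail := tsum_tail_le (show 3 ≤ m by omega) hD1 hHD.le
    have hHT : H * |T| ≤ 1 :=
      (mul_le_mul_of_nonneg_left hTle hH0).trans (by linarith)
    rw [abs_mul, abs_of_nonneg (by positivity)]
    calc Kvol m * H ^ m * |T| = Kvol m * H ^ (m - 1) * (H * |T|) := by
          rw [← Nat.sub_add_cancel (show 1 ≤ m by omega), pow_succ, Nat.add_sub_cancel]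
          ring
      _ ≤ Kvol m * H ^ (m - 1) := mul_le_of_le_one_right (by positivity) hHT
  have hfinal : 2 / 3 * Sfrak m * H ^ (m - 1) * ζ' ≤ Sfrak m / ζ' * H ^ (m - 1) := by
    have h1 : 2 / 3 * Sfrak m * ζ' ≤ Sfrak m / ζ' := by
      rw [le_div_iff₀ (by linarith)]
      have : 2 / 3 * (ζ' * ζ') ≤ 1 := by nlinarith
      nlinarith
    calc 2 / 3 * Sfrak m * H ^ (m - 1) * ζ' = 2 / 3 * Sfrak m * ζ' * H ^ (m - 1) := by ring
      _ ≤ _ := mul_le_mul_of_nonneg_right h1 (by positivity)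
  rw [hdecomp, add_mul]
  rw [abs_le] at hsum1 hsum2 hsum3 ⊢
  constructor <;> linarith [hsum1.1, hsum1.2, hsum2.1, hsum2.2, hsum3.1, hsum3.2]

/-- the number `𝒩(1,H)` of points of `ℙ(M_n(ℚ))` of Northcott–Schmidt
height at most `H` satisfies `|𝒩(1,H) − Vol(B(0,H))/(2ζ(n²))| ≤ L(1,n)·H^{n²−1} + H/2`; in
particular `K_{n²}·H^{n²}/(2ζ(n²)) − (L(1,n)·H^{n²−1} + H/2) ≤ 𝒩(1,H)`. -/
theorem rational_projective_points_count
    {n : ℕ} (hn : 2 ≤ n) (H : ℝ) (hH : 1 ≤ H) :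
    |(Set.ncard {P : Projectivization ℚ (Matrix (Fin n) (Fin n) ℚ) | heightLE P H} : ℝ) -
        (volume {M : Matrix (Fin n) (Fin n) ℝ | frobNorm M ≤ H}).toReal / (2 * zetaN (n ^ 2))| ≤
      Lone n * H ^ (n ^ 2 - 1) + H / 2 ∧
    Kvol (n ^ 2) * H ^ (n ^ 2) / (2 * zetaN (n ^ 2)) - (Lone n * H ^ (n ^ 2 - 1) + H / 2) ≤
      (Set.ncard {P : Projectivization ℚ (Matrix (Fin n) (Fin n) ℚ) | heightLE P H} : ℝ) := by
  have hH0 : 0 ≤ H := by linarith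
  have hm : 4 ≤ n ^ 2 := by nlinarith
  have hmain := abs_primitiveCount_sub_le (ι := Fin n × Fin n) (m := n ^ 2) (by simp [sq]) hm hH
  rw [← two_mul_ncard_heightLE n hH0] at hmain
  rw [volume_frobNorm_le hn hH0]
  have hz : zetaN (n ^ 2) ≠ 0 := by linarith [one_le_zetaN (show 2 ≤ n ^ 2 by omega)]
  have hbound : (Sfrak (n ^ 2) / zetaN (n ^ 2 - 1) + Kvol (n ^ 2)) * H ^ (n ^ 2 - 1) + H =
      2 * (Lone n * H ^ (n ^ 2 - 1) + H / 2) := by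
    rw [Lone, mul_comm 2 (zetaN (n ^ 2 - 1)), ← div_div]
    ring
  have hvol : Kvol (n ^ 2) * H ^ (n ^ 2) / zetaN (n ^ 2) =
      2 * (Kvol (n ^ 2) * H ^ (n ^ 2) / (2 * zetaN (n ^ 2))) := by
    rw [mul_comm 2 (zetaN (n ^ 2)), ← div_div]
    ring
  rw [hbound, hvol] at hmain
  push_cast at hmain
  have hmain' := abs_le.1 hmain
  refine ⟨abs_le.2 ⟨?_, ?_⟩, ?_⟩ <;> linarith [hmain'.1, hmain'.2]

end
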